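/- arXiv:1407.8339 — 3 statements merged into one kernel-verified Lean document; each statement's English description precedes it below -/
import Mathlib

section
/- Let X_1, ..., X_n be random variables with common support [0,1] such that E[X_t | X_1, ..., X_{t-1}] = μ almost surely for every t ≤ n. Let Y = X_1 + ... + X_n. Then for all δ with 0 < δ < 1, Pr{Y ≤ (1-δ)nμ} ≤ (e^{-δ} / (1-δ)^{(1-δ)})^{nμ}. -/
open MeasureTheory

lemma lt_step {Ω : Type*} (m : MeasurableSpace Ω) [mΩ : MeasurableSpace Ω] (P : Measure Ω) [IsProbabilityMeasure P]
    (hm : m ≤ mΩ) (G X : Ω → ℝ) (μ δ : ℝ)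
    (hX : Measurable X) (hr : ∀ ω, X ω ∈ Set.Icc (0 : ℝ) 1)
    (hG : Measurable[m] G) (hGr : ∀ ω, G ω ∈ Set.Icc (0 : ℝ) 1)
    (hc : P[X | m] =ᵐ[P] fun _ => μ) (hδ0 : 0 < δ) (hδ1 : δ < 1) :
    ∫ ω, Real.exp (Real.log (1 - δ) * X ω) * G ω ∂P ≤ Real.exp (-(δ * μ)) * ∫ ω, G ω ∂P := by
  have hGm : Measurable G := hG.mono hm le_rfl
  have iG : Integrable G P := Integrable.of_bound hGm.aestronglyMeasurable 1
    (.of_forall fun ω => by rw [Real.norm_eq_abs, abs_le]; constructor <;> linarith [(hGr ω).1, (hGr ω).2])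
  have iX : Integrable X P := Integrable.of_bound hX.aestronglyMeasurable 1
    (.of_forall fun ω => by rw [Real.norm_eq_abs, abs_le]; constructor <;> linarith [(hr ω).1, (hr ω).2])
  have iGX : Integrable (G * X) P := Integrable.of_bound (hGm.mul hX).aestronglyMeasurable 1
    (.of_forall fun ω => by
      rw [Pi.mul_apply, Real.norm_eq_abs, abs_of_nonneg (mul_nonneg (hGr ω).1 (hr ω).1)]
      exact mul_le_one₀ (hGr ω).2 (hr ω).1 (hr ω).2)
  have key : ∫ ω, (G * X) ω ∂P = μ * ∫ ω, G ω ∂P := by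
    rw [← integral_condExp hm, ← integral_const_mul]
    refine integral_congr_ae ?_
    filter_upwards [condExp_mul_of_stronglyMeasurable_left (μ := P) hG.stronglyMeasurable iGX iX, hc]
      with ω h1 h2
    rw [h1, Pi.mul_apply, h2, mul_comm]
  have hpt : ∀ ω, Real.exp (Real.log (1 - δ) * X ω) ≤ 1 - δ * X ω := fun ω => by
    rw [← Real.rpow_def_of_pos (by linarith)]
    have := rpow_one_add_le_one_add_mul_self (s := -δ) (by linarith) (hr ω).1 (hr ω).2
    rw [← sub_eq_add_neg] at this
    linarith
  calc _ ≤ ∫ ω, (G ω - δ * (G * X) ω) ∂P := by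
        refine integral_mono_of_nonneg (.of_forall fun ω => mul_nonneg (Real.exp_pos _).le (hGr ω).1)
          (iG.sub (iGX.const_mul δ)) (.of_forall fun ω => ?_)
        have := mul_le_mul_of_nonneg_right (hpt ω) (hGr ω).1
        simp only [Pi.mul_apply]
        linarith
    _ = (1 - δ * μ) * ∫ ω, G ω ∂P := by
        rw [integral_sub iG (iGX.const_mul δ), integral_const_mul, key]; ring
    _ ≤ _ := by
        refine mul_le_mul_of_nonneg_right ?_ (integral_nonneg fun ω => (hGr ω).1)
        linarith [Real.add_one_le_exp (-(δ * μ))]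

/-- Chernoff-type lower-tail bound for [0,1]-valued random variables whose
conditional expectation given the past is constantly `μ`. -/
theorem lower_tail_chernoff_unit_interval
    {Ω : Type*} [MeasurableSpace Ω] (P : Measure Ω) [IsProbabilityMeasure P]
    (n : ℕ) (X : Fin n → Ω → ℝ) (μ : ℝ)
    (hX : ∀ i, Measurable (X i))
    (hrange : ∀ i ω, X i ω ∈ Set.Icc (0 : ℝ) 1)
    (hμ : μ ∈ Set.Icc (0 : ℝ) 1)
    (hcond : ∀ t : Fin n,
      P[X t | ⨆ s : Fin n, ⨆ _ : s < t, MeasurableSpace.comap (X s) inferInstance]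
        =ᵐ[P] fun _ => μ)
    (δ : ℝ) (hδ0 : 0 < δ) (hδ1 : δ < 1) :
    P {ω | (∑ i, X i ω) ≤ (1 - δ) * n * μ}
      ≤ ENNReal.ofReal ((Real.exp (-δ) / (1 - δ) ^ (1 - δ)) ^ ((n : ℝ) * μ)) := by
  have ha : 0 < 1 - δ := by linarith
  have ht : Real.log (1 - δ) ≤ 0 := Real.log_nonpos ha.le (by linarith)
  have hGr : ∀ (s : Finset (Fin n)) ω,
      ∏ i ∈ s, Real.exp (Real.log (1 - δ) * X i ω) ∈ Set.Icc (0 : ℝ) 1 := fun s ω =>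
    ⟨Finset.prod_nonneg fun i _ => (Real.exp_pos _).le,
      Finset.prod_le_one (fun i _ => (Real.exp_pos _).le) fun i _ =>
        Real.exp_le_one_iff.2 (mul_nonpos_of_nonpos_of_nonneg ht (hrange i ω).1)⟩
  have main : ∀ k : ℕ, k ≤ n →
      ∫ ω, ∏ i ∈ Finset.univ.filter (fun i : Fin n => i.val < k),
        Real.exp (Real.log (1 - δ) * X i ω) ∂P ≤ Real.exp (-(δ * μ)) ^ k := by
    intro k
    induction k with
    | zero => intro _; simp
    | succ k ih =>
      intro hk
      have hs : Finset.univ.filter (fun i : Fin n => i.val < k + 1)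
          = insert (⟨k, hk⟩ : Fin n) (Finset.univ.filter (fun i : Fin n => i.val < k)) := by
        ext i; simp [Fin.ext_iff]; omega
      have hni : (⟨k, hk⟩ : Fin n) ∉ Finset.univ.filter (fun i : Fin n => i.val < k) := by simp
      simp only [hs, Finset.prod_insert hni]
      refine (lt_step (⨆ s : Fin n, ⨆ _ : s < (⟨k, hk⟩ : Fin n), MeasurableSpace.comap (X s) inferInstance)
        P ?_ _ _ μ δ (hX ⟨k, hk⟩) (hrange _) ?_ (hGr _) (hcond ⟨k, hk⟩) hδ0 hδ1).trans ?_
      · exact iSup₂_le fun s _ => (hX s).comap_le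
      · refine Finset.measurable_fun_prod _ fun i hi => ?_
        have hi' : i < ⟨k, hk⟩ := by simpa [Fin.lt_def] using hi
        have h1 : Measurable[⨆ s : Fin n, ⨆ _ : s < (⟨k, hk⟩ : Fin n),
            MeasurableSpace.comap (X s) inferInstance] (X i) :=
          (comap_measurable (X i)).mono
            (le_iSup₂_of_le (f := fun (s : Fin n) (_ : s < (⟨k, hk⟩ : Fin n)) =>
              MeasurableSpace.comap (X s) inferInstance) i hi' le_rfl) le_rfl
        exact Real.measurable_exp.comp (h1.const_mul _)
      · rw [pow_succ']
        exact mul_le_mul_of_nonneg_left (ih (by omega)) (Real.exp_pos _).le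
  have hm := main n le_rfl
  have e : ∀ ω, Real.exp (Real.log (1 - δ) * ∑ i, X i ω)
      = ∏ i, Real.exp (Real.log (1 - δ) * X i ω) := fun ω => by
    rw [Finset.mul_sum, Real.exp_sum]
  simp only [Fin.is_lt, Finset.filter_true] at hm
  simp only [← e] at hm hGr
  have hint : Integrable (fun ω => Real.exp (Real.log (1 - δ) * ∑ i, X i ω)) P := by
    refine Integrable.of_bound (Measurable.aestronglyMeasurable (by fun_prop)) 1
      (.of_forall fun ω => ?_)
    rw [Real.norm_eq_abs, abs_of_pos (Real.exp_pos _), e]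
    have := (hGr Finset.univ ω).2
    simpa only [e] using this
  have hch := ProbabilityTheory.measure_le_le_exp_mul_mgf (μ := P) (X := fun ω => ∑ i, X i ω)
    ((1 - δ) * n * μ) ht hint
  rw [← ofReal_measureReal]
  refine ENNReal.ofReal_le_ofReal (hch.trans ?_)
  refine (mul_le_mul_of_nonneg_left hm (Real.exp_pos _).le).trans (le_of_eq ?_)
  rw [Real.rpow_def_of_pos ha, ← Real.exp_sub, ← Real.exp_mul, ← Real.exp_nat_mul, ← Real.exp_add]
  congr 1; ring
end

section
/- Let X_1, ..., X_n be random variables with common support [0,1] such that E[X_t | X_1, ..., X_{t-1}] = μ almost surely for every t ≤ n. Let Y = X_1 + ... + X_n. Then for all δ with 0 < δ < 1, Pr{Y ≤ (1-δ)nμ} ≤ e^{-δ² n μ / 2}. -/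
open MeasureTheory

lemma aux_log (a : ℝ) (h0 : 0 < a) (h1 : a < 1) : (a ^ 2 - 1) / 2 ≤ a * Real.log a := by
  have h := (Real.self_le_sinh_iff (x := -Real.log a)).2 (by
    have := Real.log_neg h0 h1; linarith)
  rw [Real.sinh_eq, neg_neg, Real.exp_neg, Real.exp_log h0] at h
  have h2 := mul_le_mul_of_nonneg_left h h0.le
  have h3 : a * ((a⁻¹ - a) / 2) = (1 - a ^ 2) / 2 := by field_simp
  rw [h3] at h2
  linarith

lemma aux_exp (a x : ℝ) (h0 : 0 < a) (hx : x ∈ Set.Icc (0 : ℝ) 1) :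
    Real.exp (Real.log a * x) ≤ 1 - (1 - a) * x := by
  have h := convexOn_exp.2 (Set.mem_univ 0) (Set.mem_univ (Real.log a))
    (sub_nonneg.2 hx.2) hx.1 (by ring)
  simp only [smul_eq_mul, mul_zero, zero_add, Real.exp_zero, Real.exp_log h0] at h
  rw [mul_comm x] at h
  linarith

lemma aux_step {Ω : Type*} {m mΩ : MeasurableSpace Ω} (P : Measure Ω) [IsProbabilityMeasure P]
    (hm : m ≤ mΩ) (Z X : Ω → ℝ) (μ a : ℝ) (h0 : 0 < a)
    (hX : Measurable X) (hr : ∀ ω, X ω ∈ Set.Icc (0 : ℝ) 1)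
    (hZ : Measurable[m] Z) (hZr : ∀ ω, Z ω ∈ Set.Icc (0 : ℝ) 1)
    (hc : P[X | m] =ᵐ[P] fun _ => μ) :
    ∫ ω, Z ω * Real.exp (Real.log a * X ω) ∂P ≤ (1 - (1 - a) * μ) * ∫ ω, Z ω ∂P := by
  have hZ' : Measurable Z := hZ.mono hm le_rfl
  have iX : Integrable X P := Integrable.of_bound hX.aestronglyMeasurable 1
    (ae_of_all _ fun ω => by rw [Real.norm_eq_abs, abs_of_nonneg (hr ω).1]; exact (hr ω).2)
  have iZ : Integrable Z P := Integrable.of_bound hZ'.aestronglyMeasurable 1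
    (ae_of_all _ fun ω => by rw [Real.norm_eq_abs, abs_of_nonneg (hZr ω).1]; exact (hZr ω).2)
  have iZX : Integrable (Z * X) P :=
    Integrable.of_bound (hZ'.mul hX).aestronglyMeasurable 1
    (ae_of_all _ fun ω => by
      rw [Pi.mul_apply, Real.norm_eq_abs, abs_of_nonneg (mul_nonneg (hZr ω).1 (hr ω).1)]
      exact mul_le_one₀ (hZr ω).2 (hr ω).1 (hr ω).2)
  have key : ∫ ω, (Z * X) ω ∂P = μ * ∫ ω, Z ω ∂P := by
    rw [← integral_condExp hm, ← integral_const_mul]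
    apply integral_congr_ae
    filter_upwards [condExp_mul_of_stronglyMeasurable_left hZ.stronglyMeasurable iZX iX, hc]
      with ω h1 h2
    rw [h1, Pi.mul_apply, h2, mul_comm]
  calc ∫ ω, Z ω * Real.exp (Real.log a * X ω) ∂P 
      ≤ ∫ ω, (Z ω - (1 - a) * (Z * X) ω) ∂P := by
        apply integral_mono_of_nonneg
        · exact ae_of_all _ fun ω => mul_nonneg (hZr ω).1 (Real.exp_pos _).le
        · exact iZ.sub (iZX.const_mul _)
        · refine ae_of_all _ fun ω => ?_
          have := mul_le_mul_of_nonneg_left (aux_exp a _ h0 (hr ω)) (hZr ω).1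
          simp only [Pi.mul_apply]
          linarith
    _ = _ := by
        rw [integral_sub iZ (iZX.const_mul _), integral_const_mul, key]; ring

lemma aux_ind
    {Ω : Type*} [MeasurableSpace Ω] (P : Measure Ω) [IsProbabilityMeasure P]
    (n : ℕ) (X : Fin n → Ω → ℝ) (μ : ℝ)
    (hX : ∀ i, Measurable (X i))
    (hrange : ∀ i ω, X i ω ∈ Set.Icc (0 : ℝ) 1)
    (hμ : μ ∈ Set.Icc (0 : ℝ) 1)
    (hcond : ∀ t : Fin n,
      P[X t | ⨆ s : Fin n, ⨆ _ : s < t, MeasurableSpace.comap (X s) inferInstance]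
        =ᵐ[P] fun _ => μ)
    (a : ℝ) (h0 : 0 < a) (h1 : a < 1) (k : ℕ) (hk : k ≤ n) :
    ∫ ω, ∏ i with i.val < k, Real.exp (Real.log a * X i ω) ∂P ≤ (1 - (1 - a) * μ) ^ k := by
  induction k with
  | zero => simp
  | succ k ih =>
    have hf : (Finset.univ.filter fun i : Fin n => i.val < k + 1)
        = insert ⟨k, hk⟩ (Finset.univ.filter fun i : Fin n => i.val < k) := by
      ext i; simp [Fin.ext_iff]; omega
    rw [hf]
    simp_rw [Finset.prod_insert (s := Finset.univ.filter fun i : Fin n => i.val < k)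
      (a := (⟨k, hk⟩ : Fin n)) (by simp), mul_comm (Real.exp (Real.log a * X ⟨k, hk⟩ _))]
    have hpos : 0 ≤ 1 - (1 - a) * μ := by nlinarith [hμ.1, hμ.2]
    refine (aux_step P (m := ⨆ s : Fin n, ⨆ _ : s < ⟨k, hk⟩,
      MeasurableSpace.comap (X s) inferInstance) ?_ _ _ μ a h0 (hX _) (hrange _) ?_ ?_
      (hcond _)).trans ?_
    · exact iSup₂_le fun s _ => (hX s).comap_le
    · refine Finset.measurable_prod _ fun i hi => ?_
      refine Real.measurable_exp.comp (Measurable.const_mul ?_ _)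
      refine Measurable.mono (comap_measurable (X i)) ?_ le_rfl
      exact le_iSup₂_of_le i (by simpa [Fin.lt_def] using hi) le_rfl
    · intro ω
      refine ⟨Finset.prod_nonneg fun i _ => (Real.exp_pos _).le,
        Finset.prod_le_one (fun i _ => (Real.exp_pos _).le) fun i _ => ?_⟩
      exact Real.exp_le_one_iff.2
        (mul_nonpos_of_nonpos_of_nonneg (Real.log_neg h0 h1).le (hrange i ω).1)
    · rw [pow_succ']
      exact mul_le_mul_of_nonneg_left (ih (by omega)) hpos

/-- Simplified Chernoff lower-tail bound for [0,1]-valued random variables whose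
conditional expectation given the past is constantly `μ`. -/
theorem lower_tail_chernoff_unit_interval_exp_bound
    {Ω : Type*} [MeasurableSpace Ω] (P : Measure Ω) [IsProbabilityMeasure P]
    (n : ℕ) (X : Fin n → Ω → ℝ) (μ : ℝ)
    (hX : ∀ i, Measurable (X i))
    (hrange : ∀ i ω, X i ω ∈ Set.Icc (0 : ℝ) 1)
    (hμ : μ ∈ Set.Icc (0 : ℝ) 1)
    (hcond : ∀ t : Fin n,
      P[X t | ⨆ s : Fin n, ⨆ _ : s < t, MeasurableSpace.comap (X s) inferInstance]
        =ᵐ[P] fun _ => μ)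
    (δ : ℝ) (hδ0 : 0 < δ) (hδ1 : δ < 1) :
    P {ω | (∑ i, X i ω) ≤ (1 - δ) * n * μ}
      ≤ ENNReal.ofReal (Real.exp (-(δ ^ 2 * n * μ) / 2)) := by
  have h0 : 0 < 1 - δ := by linarith
  have h1 : 1 - δ < 1 := by linarith
  have hs := Real.log_neg h0 h1
  have h := aux_ind P n X μ hX hrange hμ hcond (1 - δ) h0 h1 n le_rfl
  have hint : Integrable (fun ω => Real.exp (Real.log (1 - δ) * ∑ i, X i ω)) P := by
    refine Integrable.of_bound (Measurable.aestronglyMeasurable ?_) 1 (ae_of_all _ fun ω => ?_)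
    · exact Real.measurable_exp.comp
        ((Finset.measurable_sum _ fun i _ => hX i).const_mul _)
    · rw [Real.norm_eq_abs, Real.abs_exp]
      exact Real.exp_le_one_iff.2 (mul_nonpos_of_nonpos_of_nonneg hs.le
        (Finset.sum_nonneg fun i _ => (hrange i ω).1))
  have hM := ProbabilityTheory.measure_le_le_exp_mul_mgf (μ := P)
    (X := fun ω => ∑ i, X i ω) ((1 - δ) * n * μ) hs.le hint
  rw [← ofReal_measureReal]
  apply ENNReal.ofReal_le_ofReal
  refine hM.trans ?_
  have hmgf : ProbabilityTheory.mgf (fun ω => ∑ i, X i ω) P (Real.log (1 - δ))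
      ≤ Real.exp (-(δ * n * μ)) := by
    unfold ProbabilityTheory.mgf
    simp only [Fin.is_lt, Finset.filter_true, ← Real.exp_sum, ← Finset.mul_sum] at h
    refine h.trans ?_
    have h2 : 1 - (1 - (1 - δ)) * μ ≤ Real.exp (-(δ * μ)) := by
      have := Real.add_one_le_exp (-(δ * μ)); linarith
    refine (pow_le_pow_left₀ (by nlinarith [hμ.1, hμ.2]) h2 n).trans ?_
    rw [← Real.exp_nat_mul]
    exact Real.exp_le_exp.2 (by linarith)
  refine (mul_le_mul_of_nonneg_left hmgf (Real.exp_pos _).le).trans ?_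
  rw [← Real.exp_add, Real.exp_le_exp]
  have hl := aux_log (1 - δ) h0 h1
  have hn : 0 ≤ (n : ℝ) * μ := mul_nonneg n.cast_nonneg hμ.1
  have := mul_le_mul_of_nonneg_left hl hn
  nlinarith
end

section
/- Let X_1, ..., X_n be {0,1}-valued random variables such that E[X_t | X_1, ..., X_{t-1}] = μ almost surely for every t ≤ n. Let Y = X_1 + ... + X_n. Then for all δ with 0 < δ < 1, Pr{Y ≤ (1-δ)nμ} ≤ (e^{-δ} / (1-δ)^{(1-δ)})^{nμ}. -/
open MeasureTheory

theorem aux_prod_int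
    {Ω : Type*} [MeasurableSpace Ω] (P : Measure Ω) [IsProbabilityMeasure P]
    (n : ℕ) (X : Fin n → Ω → ℝ) (μ : ℝ)
    (hX : ∀ i, Measurable (X i))
    (hrange : ∀ i ω, X i ω = 0 ∨ X i ω = 1)
    (hcond : ∀ t : Fin n,
      P[X t | ⨆ s : Fin n, ⨆ _ : s < t, MeasurableSpace.comap (X s) inferInstance]
        =ᵐ[P] fun _ => μ)
    (δ : ℝ) (hδ0 : 0 < δ) (hδ1 : δ < 1) (k : ℕ) (hk : k ≤ n) :
    ∫ ω, ∏ i ∈ Finset.univ.filter (fun i : Fin n => i.val < k), (1 - δ * X i ω) ∂P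
      = (1 - δ * μ) ^ k := by
  induction k with
  | zero => simp
  | succ k ih =>
    have ih := ih (by omega)
    let t : Fin n := ⟨k, by omega⟩
    let M : Ω → ℝ := fun ω => ∏ i ∈ Finset.univ.filter (fun i : Fin n => i.val < k), (1 - δ * X i ω)
    have hset : Finset.univ.filter (fun i : Fin n => i.val < k + 1)
        = insert t (Finset.univ.filter (fun i : Fin n => i.val < k)) := by
      ext i
      simp only [Finset.mem_filter, Finset.mem_univ, true_and, Finset.mem_insert, t, Fin.ext_iff]
      omega
    have hnot : t ∉ Finset.univ.filter (fun i : Fin n => i.val < k) := by simp [t]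
    have hle : (⨆ s : Fin n, ⨆ _ : s < t, MeasurableSpace.comap (X s) inferInstance)
        ≤ (inferInstance : MeasurableSpace Ω) :=
      iSup_le fun s => iSup_le fun _ => (hX s).comap_le
    have hMm : Measurable[⨆ s : Fin n, ⨆ _ : s < t,
        MeasurableSpace.comap (X s) inferInstance] M := by
      refine Finset.measurable_prod _ fun i hi => ?_
      have hit : i < t := by simpa [t, Fin.lt_def] using hi
      have h1 : Measurable[⨆ s : Fin n, ⨆ _ : s < t,
          MeasurableSpace.comap (X s) inferInstance] (X i) :=
        (comap_measurable (X i)).mono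
          (le_iSup₂_of_le (f := fun (s : Fin n) (_ : s < t) =>
            MeasurableSpace.comap (X s) inferInstance) i hit le_rfl) le_rfl
      exact (h1.const_mul δ).const_sub 1
    have hMb : ∀ ω, ‖M ω‖ ≤ 1 := by
      intro ω
      simp only [M, norm_prod]
      refine Finset.prod_le_one (fun _ _ => norm_nonneg _) fun i _ => ?_
      rw [Real.norm_eq_abs, abs_le]
      rcases hrange i ω with h | h <;> rw [h] <;> constructor <;> linarith
    have hMm0 : Measurable M := hMm.mono hle le_rfl
    have hMi : Integrable M P :=
      Integrable.of_bound hMm0.aestronglyMeasurable 1 (Filter.Eventually.of_forall hMb)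
    have hXb : ∀ ω, ‖X t ω‖ ≤ 1 := by
      intro ω
      rcases hrange t ω with h | h <;> simp [h]
    have hXi : Integrable (X t) P :=
      Integrable.of_bound (hX t).aestronglyMeasurable 1 (Filter.Eventually.of_forall hXb)
    have hMX : Integrable (M * X t) P :=
      Integrable.of_bound (hMm0.mul (hX t)).aestronglyMeasurable 1
        (Filter.Eventually.of_forall fun ω => by
          simp only [Pi.mul_apply, norm_mul]
          exact mul_le_one₀ (hMb ω) (norm_nonneg _) (hXb ω))
    have key : ∫ ω, (M * X t) ω ∂P = (∫ ω, M ω ∂P) * μ := by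
      rw [← integral_condExp hle, ← integral_mul_const]
      refine integral_congr_ae ?_
      filter_upwards [condExp_mul_of_stronglyMeasurable_left hMm.stronglyMeasurable hMX hXi,
        hcond t] with ω h1 h2
      rw [h1, Pi.mul_apply, h2]
    have e : ∀ ω, ∏ i ∈ Finset.univ.filter (fun i : Fin n => i.val < k + 1), (1 - δ * X i ω)
        = M ω - δ * (M * X t) ω := by
      intro ω
      rw [hset, Finset.prod_insert hnot]
      simp only [M, Pi.mul_apply]
      ring
    simp_rw [e]
    rw [integral_sub hMi (hMX.const_mul δ), integral_const_mul, key]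
    change ∫ ω, M ω ∂P = _ at ih
    rw [ih]
    ring

/-- Chernoff-type lower-tail bound for {0,1}-valued random variables whose
conditional expectation given the past is constantly `μ`. -/
theorem lower_tail_chernoff_bernoulli
    {Ω : Type*} [MeasurableSpace Ω] (P : Measure Ω) [IsProbabilityMeasure P]
    (n : ℕ) (X : Fin n → Ω → ℝ) (μ : ℝ)
    (hX : ∀ i, Measurable (X i))
    (hrange : ∀ i ω, X i ω = 0 ∨ X i ω = 1)
    (hμ : μ ∈ Set.Icc (0 : ℝ) 1)
    (hcond : ∀ t : Fin n,
      P[X t | ⨆ s : Fin n, ⨆ _ : s < t, MeasurableSpace.comap (X s) inferInstance]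
        =ᵐ[P] fun _ => μ)
    (δ : ℝ) (hδ0 : 0 < δ) (hδ1 : δ < 1) :
    P {ω | (∑ i, X i ω) ≤ (1 - δ) * n * μ}
      ≤ ENNReal.ofReal ((Real.exp (-δ) / (1 - δ) ^ (1 - δ)) ^ ((n : ℝ) * μ)) := by
  obtain ⟨hμ0, hμ1⟩ := hμ
  have ha : 0 < 1 - δ := by linarith
  have hint := aux_prod_int P n X μ hX hrange hcond δ hδ0 hδ1 n le_rfl
  have hpow : ∀ ω, ∏ i ∈ Finset.univ.filter (fun i : Fin n => i.val < n), (1 - δ * X i ω)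
      = (1 - δ) ^ (∑ i, X i ω) := by
    intro ω
    rw [Real.rpow_sum_of_pos ha, Finset.filter_true_of_mem (fun i _ => i.isLt)]
    refine Finset.prod_congr rfl fun i _ => ?_
    rcases hrange i ω with h | h <;> simp [h]
  simp_rw [hpow] at hint
  set c : ℝ := (1 - δ) ^ ((1 - δ) * n * μ) with hc
  have hcpos : 0 < c := Real.rpow_pos_of_pos ha _
  have hYm : Measurable fun ω => (1 - δ) ^ (∑ i, X i ω) :=
    (Finset.measurable_sum _ fun i _ => hX i).const_pow _
  have hYi : Integrable (fun ω => (1 - δ) ^ (∑ i, X i ω)) P := by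
    refine Integrable.of_bound hYm.aestronglyMeasurable 1 (Filter.Eventually.of_forall fun ω => ?_)
    rw [Real.norm_eq_abs, abs_of_pos (Real.rpow_pos_of_pos ha _)]
    refine Real.rpow_le_one ha.le (by linarith) (Finset.sum_nonneg fun i _ => ?_)
    rcases hrange i ω with h | h <;> simp [h]
  have hmk := mul_meas_ge_le_integral_of_nonneg
    (Filter.Eventually.of_forall fun ω => (Real.rpow_pos_of_pos ha (∑ i, X i ω)).le) hYi c
  rw [hint] at hmk
  have hsub : {ω | (∑ i, X i ω) ≤ (1 - δ) * n * μ} ⊆ {ω | c ≤ (1 - δ) ^ (∑ i, X i ω)} := by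
    intro ω hω
    exact Real.rpow_le_rpow_of_exponent_ge ha (by linarith) hω
  have hb : (1 - δ * μ) ^ n ≤ Real.exp (-δ * (n * μ)) := by
    have h0 : 0 ≤ 1 - δ * μ := by nlinarith
    calc (1 - δ * μ) ^ n ≤ (Real.exp (-(δ * μ))) ^ n := by
          gcongr
          linarith [Real.add_one_le_exp (-(δ * μ))]
      _ = _ := by rw [← Real.exp_nat_mul]; congr 1; ring
  have hR : (Real.exp (-δ) / (1 - δ) ^ (1 - δ)) ^ ((n : ℝ) * μ)
      = Real.exp (-δ * (n * μ)) / c := by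
    rw [Real.div_rpow (Real.exp_pos _).le (Real.rpow_pos_of_pos ha _).le, ← Real.exp_mul,
      ← Real.rpow_mul ha.le, hc, mul_assoc (1 - δ)]
  rw [hR]
  refine (measure_mono hsub).trans ?_
  rw [← ofReal_measureReal]
  refine ENNReal.ofReal_le_ofReal ?_
  rw [le_div_iff₀ hcpos, mul_comm]
  exact hmk.trans hb
end
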